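/- For all n ≥ m ≥ 2, Dominator has a winning strategy in both the D-game and the S-game of the Maker-Breaker domination game on the grid graph P_m □ P_n, i.e., o(P_m □ P_n) = D. -/

import Mathlib

open SimpleGraph

namespace MBD

variable {V : Type*}

/-- Dominator's claimed set `D` is a dominating set of `G`. -/
def Dominates (G : SimpleGraph V) (D : Finset V) : Prop :=
  ∀ v : V, ∃ d ∈ D, d = v ∨ G.Adj d v

/-- Staller's claimed set `S` contains the whole closed neighborhood of some vertex. -/
def StallerWinSet (G : SimpleGraph V) (S : Finset V) : Prop :=
  ∃ v : V, ∀ u : V, (u = v ∨ G.Adj u v) → u ∈ S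

variable [DecidableEq V]

mutual
  /-- `DomD G k D S`: with Dominator having claimed `D`, Staller `S`, and Dominator to
  move, Dominator has a strategy winning the Maker-Breaker domination game on `G`
  using at most `k` further moves of his own. -/
  inductive DomD (G : SimpleGraph V) : ℕ → Finset V → Finset V → Prop
    | win {k : ℕ} {D S : Finset V} : Dominates G D → DomD G k D S
    | move {k : ℕ} {D S : Finset V} (v : V) : v ∉ D → v ∉ S →
        DomS G k (insert v D) S → DomD G (k + 1) D S
  /-- Like `DomD`, but it is Staller's turn to move. -/
  inductive DomS (G : SimpleGraph V) : ℕ → Finset V → Finset V → Prop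
    | win {k : ℕ} {D S : Finset V} : Dominates G D → DomS G k D S
    | move {k : ℕ} {D S : Finset V} : (∃ v : V, v ∉ D ∧ v ∉ S) →
        (∀ v : V, v ∉ D → v ∉ S → DomD G k D (insert v S)) → DomS G k D S
end

mutual
  /-- `StallD G k D S`: with Dominator having claimed `D`, Staller `S`, and Dominator to
  move, Staller has a strategy winning (claiming a whole closed neighborhood) within at
  most `k` further moves of her own. -/
  inductive StallD (G : SimpleGraph V) : ℕ → Finset V → Finset V → Prop
    | win {k : ℕ} {D S : Finset V} : StallerWinSet G S → StallD G k D S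
    | move {k : ℕ} {D S : Finset V} : (∃ v : V, v ∉ D ∧ v ∉ S) →
        (∀ v : V, v ∉ D → v ∉ S → StallS G k (insert v D) S) → StallD G k D S
  /-- Like `StallD`, but it is Staller's turn to move. -/
  inductive StallS (G : SimpleGraph V) : ℕ → Finset V → Finset V → Prop
    | win {k : ℕ} {D S : Finset V} : StallerWinSet G S → StallS G k D S
    | move {k : ℕ} {D S : Finset V} (v : V) : v ∉ D → v ∉ S →
        StallD G k D (insert v S) → StallS G (k + 1) D S
end

/-- Dominator has a winning strategy in the D-game (Dominator starts). -/
def DominatorWinsD (G : SimpleGraph V) : Prop := ∃ k, DomD G k ∅ ∅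

/-- Dominator has a winning strategy in the S-game (Staller starts). -/
def DominatorWinsS (G : SimpleGraph V) : Prop := ∃ k, DomS G k ∅ ∅

/-- Staller has a winning strategy in the D-game (Dominator starts). -/
def StallerWinsD (G : SimpleGraph V) : Prop := ∃ k, StallD G k ∅ ∅

/-- Staller has a winning strategy in the S-game (Staller starts). -/
def StallerWinsS (G : SimpleGraph V) : Prop := ∃ k, StallS G k ∅ ∅

/-- Outcome `𝒟`: Dominator wins both the D-game and the S-game. -/
def outcomeD (G : SimpleGraph V) : Prop := DominatorWinsD G ∧ DominatorWinsS G

/-- Outcome `𝒮`: Staller wins both the D-game and the S-game. -/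
def outcomeS (G : SimpleGraph V) : Prop := StallerWinsD G ∧ StallerWinsS G

/-- Outcome `𝒩`: the first player wins in both games. -/
def outcomeN (G : SimpleGraph V) : Prop := DominatorWinsD G ∧ StallerWinsS G

/-- `γ_MB(G)`: the minimum number of Dominator's moves needed to win the D-game,
`∞` if he has no winning strategy. -/
noncomputable def gMB (G : SimpleGraph V) : ℕ∞ :=
  sInf ((fun k : ℕ => (k : ℕ∞)) '' {k | DomD G k ∅ ∅})

/-- `γ_MB'(G)`: the minimum number of Dominator's moves needed to win the S-game. -/
noncomputable def gMB' (G : SimpleGraph V) : ℕ∞ :=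
  sInf ((fun k : ℕ => (k : ℕ∞)) '' {k | DomS G k ∅ ∅})

/-- `γ_SMB(G)`: the minimum number of Staller's moves needed to win the D-game. -/
noncomputable def gSMB (G : SimpleGraph V) : ℕ∞ :=
  sInf ((fun k : ℕ => (k : ℕ∞)) '' {k | StallD G k ∅ ∅})

/-- `γ_SMB'(G)`: the minimum number of Staller's moves needed to win the S-game. -/
noncomputable def gSMB' (G : SimpleGraph V) : ℕ∞ :=
  sInf ((fun k : ℕ => (k : ℕ∞)) '' {k | StallS G k ∅ ∅})

end MBD

namespace MBD

variable {V W : Type*}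

/-- An invariant `I` of positions with Staller to move that Dominator can maintain: Staller owns
no closed neighborhood, and every move of Staller has a reply (possibly a vertex that Dominator
already owns) restoring `I`. -/
def IsInvariant [DecidableEq V] (G : SimpleGraph V) (I : Finset V → Finset V → Prop) : Prop :=
  ∀ D S, I D S → (∀ u, ∃ x ∉ S, x = u ∨ G.Adj x u) ∧
    ∀ v ∉ D, v ∉ S → ∃ w ∉ insert v S, I (insert w D) (insert v S)

theorem Dominates.of_forall_mem {G : SimpleGraph V} {D S : Finset V}
    (hS : ∀ u, ∃ x ∉ S, x = u ∨ G.Adj x u) (h : ∀ v, v ∉ S → v ∈ D) : Dominates G D := fun u ↦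
  let ⟨x, hx, hxu⟩ := hS u
  ⟨x, h x hx, hxu⟩

/-- Owning more vertices than an invariant position requires never hurts Dominator. -/
theorem IsInvariant.domS [Fintype V] [DecidableEq V] {G : SimpleGraph V}
    {I : Finset V → Finset V → Prop} (hI : IsInvariant G I) (k : ℕ) (D₀ D S : Finset V) (h : I D₀ S) (hD : D₀ ⊆ D)
    (hDS : Disjoint D S) (hk : (D ∪ S)ᶜ.card ≤ k) : DomS G k D S := by
  induction k generalizing D₀ D S with
  | zero =>
    refine .win (.of_forall_mem (hI _ _ h).1 fun v hv ↦ ?_)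
    have := Finset.ext_iff.1 (Finset.card_eq_zero.1 (Nat.le_zero.1 hk)) v
    simp at this
    tauto
  | succ k ih =>
    by_cases hfree : ∃ v, v ∉ D ∧ v ∉ S
    · refine .move hfree fun v hvD hvS ↦ ?_
      obtain ⟨w, hwS, hw⟩ := (hI _ _ h).2 v (fun hv ↦ hvD (hD hv)) hvS
      have play (u : V) (huD : u ∉ D) (huS : u ∉ insert v S) (hsub : insert w D₀ ⊆ insert u D) :
          DomD G (k + 1) D (insert v S) := by
        refine .move u huD huS (ih _ _ _ hw hsub ?_ ?_)
        · rw [Finset.disjoint_left] at hDS ⊢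
          grind
        · refine Nat.le_of_lt_succ ((Finset.card_lt_card ?_).trans_le hk)
          rw [Finset.ssubset_iff_of_subset (Finset.compl_subset_compl.2
            (Finset.union_subset_union (Finset.subset_insert _ _) (Finset.subset_insert _ _)))]
          exact ⟨v, by simp [hvD, hvS], by simp⟩
      by_cases hwD : w ∈ D
      · by_cases hu : ∃ u ∉ D, u ∉ insert v S
        · obtain ⟨u, huD, huS⟩ := hu
          exact play u huD huS (by grind)
        · exact .win (.of_forall_mem (hI _ _ hw).1 fun x hx ↦ by_contra fun hxD ↦ hu ⟨x, hxD, hx⟩)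
      · exact play w hwD hwS (Finset.insert_subset_insert w hD)
    · exact .win (.of_forall_mem (hI _ _ h).1 fun v hv ↦ by_contra fun hvD ↦ hfree ⟨v, hvD, hv⟩)

theorem IsInvariant.outcomeD [Fintype V] [DecidableEq V] [Nonempty V] {G : SimpleGraph V}
    {I : Finset V → Finset V → Prop} (hI : IsInvariant G I) (h : I ∅ ∅) : outcomeD G := by
  obtain ⟨x⟩ := ‹Nonempty V›
  exact ⟨⟨_, .move x (by simp) (by simp)
    (hI.domS _ _ (insert x ∅) _ h (by simp) (by simp) le_rfl)⟩,
    ⟨_, hI.domS _ _ _ _ h subset_rfl (by simp) le_rfl⟩⟩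

/-- Dominator has, against each opening move `v` of Staller, a reply `w` after which a pairing `g`
of the remaining vertices takes care of every closed neighborhood avoiding `w`. -/
def HasPairingReplies (H : SimpleGraph W) : Prop :=
  ∀ v, ∃ w ≠ v, ∃ g : W → W, g.Involutive ∧ g v = v ∧ g w = w ∧
    ∀ u, (w = u ∨ H.Adj w u) ∨ ∃ x, g x ≠ x ∧ (x = u ∨ H.Adj x u) ∧ (g x = u ∨ H.Adj (g x) u)

/-- Dominator owns the partner under `f` of each of Staller's vertices, and each closed
neighborhood contains one of his vertices or a pair. -/
def PairingPosition (G : SimpleGraph V) (D S : Finset V) : Prop :=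
  Disjoint D S ∧ D.Nonempty ∧ ∃ f : V → V, f.Involutive ∧ (∀ x ∈ S, f x ≠ x → f x ∈ D) ∧
    ∀ u, (∃ d ∈ D, d = u ∨ G.Adj d u) ∨
      ∃ x, f x ≠ x ∧ (x = u ∨ G.Adj x u) ∧ (f x = u ∨ G.Adj (f x) u)

/-- Pairing outside a core that Staller has not entered, the core being the set of fixed points. -/
def OpeningPosition (f : V → V) (D S : Finset V) : Prop :=
  Disjoint D S ∧ ∀ x ∈ S, f x ≠ x ∧ f x ∈ D

theorem isInvariant_of_pairing_of_core [DecidableEq V] {G : SimpleGraph V} {H : SimpleGraph W}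
    {f : V → V} {e : W → V} (hf : f.Involutive) (hadj : ∀ x, f x ≠ x → G.Adj x (f x))
    (he : e.Injective) (hcore : ∀ x, f x = x ↔ ∃ y, e y = x)
    (hHG : ∀ x y, H.Adj x y → G.Adj (e x) (e y)) (hH : HasPairingReplies H) :
    IsInvariant G fun D S ↦ OpeningPosition f D S ∨ PairingPosition G D S := by
  rintro D S (⟨hDS, hS⟩ | ⟨hDS, ⟨d, hd⟩, g, hg, hS, hu⟩) <;> rw [Finset.disjoint_left] at hDS
  · refine ⟨fun u ↦ ?_, fun v hvD hvS ↦ ?_⟩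
    · by_cases huS : u ∈ S
      · exact ⟨f u, hDS (hS u huS).2, .inr (hadj u (hS u huS).1).symm⟩
      · exact ⟨u, huS, .inl rfl⟩
    by_cases hv : f v = v
    · obtain ⟨y, rfl⟩ := (hcore v).1 hv
      obtain ⟨w, hwy, g, hg, hgy, hgw, hdom⟩ := hH y
      have hwS : e w ∉ S := fun h ↦ (hS _ h).1 ((hcore _).2 ⟨w, rfl⟩)
      have hext (x : W) : Function.extend e (e ∘ g) f (e x) = e (g x) := he.extend_apply _ _ _
      have hext' (x : V) (hx : f x ≠ x) : Function.extend e (e ∘ g) f x = f x :=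
        Function.extend_apply' _ _ _ fun h ↦ hx ((hcore x).2 h)
      refine ⟨e w, by simp [he.eq_iff, hwy, hwS], .inr ⟨?_, ⟨e w, by simp⟩,
        Function.extend e (e ∘ g) f, fun x ↦ ?_, fun x hx hgx ↦ ?_, fun u ↦ ?_⟩⟩
      · rw [Finset.disjoint_left]
        grind
      · by_cases hx : f x = x
        · obtain ⟨x, rfl⟩ := (hcore x).1 hx
          rw [hext, hext, hg]
        · rw [hext' x hx, hext' _ (by rwa [hf, ne_comm]), hf]
      · obtain rfl | hx := Finset.mem_insert.1 hx
        · exact absurd (by rw [hext, hgy]) hgx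
        · rw [hext' x (hS x hx).1]
          exact Finset.mem_insert_of_mem (hS x hx).2
      · by_cases hu : f u = u
        · obtain ⟨u, rfl⟩ := (hcore u).1 hu
          obtain h | ⟨x, hx, hxu, hgu⟩ := hdom u
          · exact .inl ⟨e w, by simp, h.imp (congrArg e) (hHG _ _)⟩
          · exact .inr ⟨e x, by rwa [hext, he.ne_iff], hxu.imp (congrArg e) (hHG _ _),
              by simpa only [hext] using hgu.imp (congrArg e) (hHG _ _)⟩
        · exact .inr ⟨u, by rwa [hext' u hu], .inl rfl,
            by rw [hext' u hu]; exact .inr (hadj u hu).symm⟩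
    · have hfv : f v ∉ S := fun h ↦ hvD (by simpa [hf v] using (hS _ h).2)
      refine ⟨f v, by simp [hv, hfv], .inl ⟨?_, fun x hx ↦ ?_⟩⟩
      · rw [Finset.disjoint_left]
        grind
      · grind
  · refine ⟨fun u ↦ ?_, fun v hvD hvS ↦ ?_⟩
    · obtain ⟨x, hx, hxu⟩ | ⟨x, hx, hxu, hgu⟩ := hu u
      · exact ⟨x, hDS hx, hxu⟩
      · by_cases hxS : x ∈ S
        · exact ⟨g x, hDS (hS x hxS hx), hgu⟩
        · exact ⟨x, hxS, hxu⟩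
    have of_reply (w : V) (hw : w ∉ insert v S) (hvw : g v ≠ v → g v = w) :
        PairingPosition G (insert w D) (insert v S) := by
      refine ⟨?_, by simp, g, hg, ?_, fun u ↦ (hu u).imp_left fun ⟨x, hx, hxu⟩ ↦
        ⟨x, Finset.mem_insert_of_mem hx, hxu⟩⟩
      · rw [Finset.disjoint_left]
        grind
      · grind
    by_cases hv : g v = v
    · have hd' : d ∉ insert v S := by
        rw [Finset.mem_insert, not_or]
        exact ⟨ne_of_mem_of_not_mem hd hvD, hDS hd⟩
      exact ⟨d, hd', .inr (of_reply d hd' (absurd hv))⟩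
    · have hgv : g v ∉ insert v S := by
        rw [Finset.mem_insert, not_or]
        exact ⟨hv, fun h ↦ hvD (by simpa [hg v] using hS _ h (by rwa [hg, ne_comm]))⟩
      exact ⟨g v, hgv, .inr (of_reply _ hgv fun _ ↦ rfl)⟩

/-- If `m - c` is even, the path on `m` vertices has a perfect matching of its part
beyond the first `c` vertices. -/
theorem exists_pathGraph_matching {m c : ℕ} (h : Even (m - c)) :
    ∃ s : Fin m → Fin m, s.Involutive ∧ (∀ i, s i = i ↔ i.val < c) ∧
      ∀ i, s i ≠ i → (pathGraph m).Adj i (s i) := by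
  rw [Nat.even_iff] at h
  refine ⟨fun i ↦ if hi : i.val < c then i else
    if hp : (i.val - c) % 2 = 0 then ⟨i + 1, by omega⟩ else ⟨i - 1, by omega⟩, ?_, ?_, ?_⟩
  · intro i
    grind
  · intro i
    grind
  · intro i hi
    rw [pathGraph_adj]
    grind

open Equiv in
theorem hasPairingReplies_three : HasPairingReplies (pathGraph 3 □ pathGraph 3) := by
  have adj (x y : Fin 3 × Fin 3) : (pathGraph 3 □ pathGraph 3).Adj x y ↔
      (x.1.val + 1 = y.1.val ∨ y.1.val + 1 = x.1.val) ∧ x.2 = y.2 ∨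
        (x.2.val + 1 = y.2.val ∨ y.2.val + 1 = x.2.val) ∧ x.1 = y.1 := by
    simp only [boxProd_adj, pathGraph_adj]
  simp only [HasPairingReplies, adj]
  rintro ⟨i, j⟩
  fin_cases i <;> fin_cases j
  · exact ⟨(0, 1), by decide,
      ⇑(swap (1, 0) (1, 1) * swap (1, 2) (2, 2) * swap (2, 0) (2, 1) : Perm (Fin 3 × Fin 3)),
      fun x ↦ by revert x; decide, by decide, by decide, by decide⟩
  · exact ⟨(1, 0), by decide,
      ⇑(swap (0, 0) (1, 1) * swap (0, 2) (1, 2) * swap (2, 1) (2, 2) : Perm (Fin 3 × Fin 3)),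
      fun x ↦ by revert x; decide, by decide, by decide, by decide⟩
  · exact ⟨(1, 2), by decide,
      ⇑(swap (0, 0) (0, 1) * swap (1, 0) (1, 1) * swap (2, 0) (2, 1) : Perm (Fin 3 × Fin 3)),
      fun x ↦ by revert x; decide, by decide, by decide, by decide⟩
  · exact ⟨(2, 1), by decide,
      ⇑(swap (0, 0) (0, 1) * swap (0, 2) (1, 2) * swap (1, 1) (2, 0) : Perm (Fin 3 × Fin 3)),
      fun x ↦ by revert x; decide, by decide, by decide, by decide⟩
  · exact ⟨(0, 1), by decide,
      ⇑(swap (0, 0) (1, 0) * swap (1, 2) (2, 2) * swap (2, 0) (2, 1) : Perm (Fin 3 × Fin 3)),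
      fun x ↦ by revert x; decide, by decide, by decide, by decide⟩
  · exact ⟨(0, 1), by decide,
      ⇑(swap (1, 0) (2, 0) * swap (0, 2) (1, 1) * swap (2, 1) (2, 2) : Perm (Fin 3 × Fin 3)),
      fun x ↦ by revert x; decide, by decide, by decide, by decide⟩
  · exact ⟨(1, 0), by decide,
      ⇑(swap (0, 0) (0, 1) * swap (0, 2) (1, 2) * swap (2, 1) (2, 2) : Perm (Fin 3 × Fin 3)),
      fun x ↦ by revert x; decide, by decide, by decide, by decide⟩
  · exact ⟨(1, 2), by decide,
      ⇑(swap (0, 0) (0, 1) * swap (1, 0) (2, 0) * swap (1, 1) (2, 2) : Perm (Fin 3 × Fin 3)),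
      fun x ↦ by revert x; decide, by decide, by decide, by decide⟩
  · exact ⟨(2, 1), by decide,
      ⇑(swap (0, 0) (0, 1) * swap (0, 2) (1, 2) * swap (1, 0) (1, 1) : Perm (Fin 3 × Fin 3)),
      fun x ↦ by revert x; decide, by decide, by decide, by decide⟩

end MBD

/-- For all `n ≥ m ≥ 2`, Dominator wins both the D-game and the S-game on the grid
`P_m □ P_n`, i.e. `o(P_m □ P_n) = 𝒟`. -/
theorem stmt_12 (m n : ℕ) (hm : 2 ≤ m) (hmn : m ≤ n) :
    MBD.outcomeD (SimpleGraph.pathGraph m □ SimpleGraph.pathGraph n) := by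
  have exists_core (k : ℕ) (hk : 2 ≤ k) : ∃ c ≤ k, (c = 0 ∨ c = 3) ∧ Even (k - c) := by
    rcases Nat.even_or_odd k with h | h
    · exact ⟨0, by simp, by simp, h⟩
    · rw [Nat.odd_iff] at h
      exact ⟨3, by omega, by simp, by rw [Nat.even_iff]; omega⟩
  obtain ⟨c, hcm, hc, hc'⟩ := exists_core m hm
  obtain ⟨d, hdn, hd, hd'⟩ := exists_core n (hm.trans hmn)
  obtain ⟨s, hs, hs_fix, hs_adj⟩ := MBD.exists_pathGraph_matching hc'
  obtain ⟨t, ht, ht_fix, ht_adj⟩ := MBD.exists_pathGraph_matching hd'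
  have : Nonempty (Fin m × Fin n) := ⟨⟨0, by omega⟩, ⟨0, by omega⟩⟩
  let f : Fin m × Fin n → Fin m × Fin n := fun x ↦
    if s x.1 = x.1 then (x.1, t x.2) else (s x.1, x.2)
  let e : Fin c × Fin d → Fin m × Fin n := Prod.map (Fin.castLE hcm) (Fin.castLE hdn)
  have hH : MBD.HasPairingReplies (pathGraph c □ pathGraph d) := by
    rcases hc with rfl | rfl
    · exact fun v ↦ v.1.elim0
    rcases hd with rfl | rfl
    · exact fun v ↦ v.2.elim0
    exact MBD.hasPairingReplies_three
  refine (MBD.isInvariant_of_pairing_of_core (f := f) (e := e) ?_ ?_ ?_ ?_ ?_ hH).outcomeD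
    (.inl ⟨by simp, by simp⟩)
  · rintro ⟨i, j⟩
    have := hs i
    have := ht j
    grind
  · rintro ⟨i, j⟩ hij
    rw [boxProd_adj]
    have := hs_adj i
    have := ht_adj j
    grind
  · exact (Fin.castLE_injective hcm).prodMap (Fin.castLE_injective hdn)
  · rintro ⟨i, j⟩
    have hfix : f (i, j) = (i, j) ↔ i.val < c ∧ j.val < d := by
      rw [← hs_fix, ← ht_fix]
      grind
    rw [hfix]
    refine ⟨fun h ↦ ⟨(⟨i, h.1⟩, ⟨j, h.2⟩), rfl⟩, ?_⟩
    rintro ⟨⟨a, b⟩, h⟩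
    simp only [e, Prod.map_apply, Prod.mk.injEq] at h
    simp [← h.1, ← h.2]
  · rintro ⟨a, b⟩ ⟨a', b'⟩ h
    simpa [e, boxProd_adj, pathGraph_adj] using h
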